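/- Let 𝔫 : ℝ⁴ → ℂ be a Schwartz function. For Schwartz functions f, g, h : ℝ → ℂ, the limit m(ξ) := lim_{δ→0⁺} ∭_{|ξ₃| ≥ δ} 𝔫(ξ, ξ₁, ξ₂, ξ₃) f̂(ξ₁) ĝ(ξ₂) ĥ(ξ − ξ₁ − ξ₂ − ξ₃) cosech(πξ₃/2) dξ₁ dξ₂ dξ₃ exists for every ξ ∈ ℝ, and the function T_𝔫[f,g,h] with Fourier transform m satisfies: there exists an absolute constant C such that for all exponents 1 ≤ p, p₁, p₂, p₃ ≤ ∞ with 1/p = 1/p₁ + 1/p₂ + 1/p₃ (convention 1/∞ = 0), ‖T_𝔫[f,g,h]‖_{L^p(ℝ)} ≤ C ‖ℱ⁻¹[𝔫]‖_{L¹(ℝ⁴)} ‖f‖_{L^{p₁}(ℝ)} ‖g‖_{L^{p₂}(ℝ)} ‖h‖_{L^{p₃}(ℝ)}. -/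

import Mathlib

open MeasureTheory Filter Topology
open scoped ENNReal

noncomputable section

/-- `cosech x = 1 / sinh x`. -/
def csch (x : ℝ) : ℝ := 1 / Real.sinh x

/-- The Fourier transform `f̂(ξ) = (2π)^{-1/2} ∫ e^{-ixξ} f(x) dx`. -/
def FT (f : ℝ → ℂ) (ξ : ℝ) : ℂ :=
  (Real.sqrt (2 * Real.pi) : ℂ)⁻¹ * ∫ x : ℝ, Complex.exp (-(Complex.I * (x : ℂ) * (ξ : ℂ))) * f x

/-- The truncated symbol integral over `{|ξ₃| ≥ δ}`. -/
def pvIntegral (n : ℝ × ℝ × ℝ × ℝ → ℂ) (f g h : ℝ → ℂ) (ξ δ : ℝ) : ℂ :=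
  ∫ ξ₃ in {y : ℝ | δ ≤ |y|}, ∫ ξ₂ : ℝ, ∫ ξ₁ : ℝ,
    n (ξ, ξ₁, ξ₂, ξ₃) * FT f ξ₁ * FT g ξ₂ * FT h (ξ - ξ₁ - ξ₂ - ξ₃) *
      (csch (Real.pi * ξ₃ / 2) : ℂ)

/-- The principal-value symbol `m(ξ) = lim_{δ→0⁺}` of the truncated integrals. -/
def pvSymbol (n : ℝ × ℝ × ℝ × ℝ → ℂ) (f g h : ℝ → ℂ) (ξ : ℝ) : ℂ :=
  limUnder (𝓝[>] (0 : ℝ)) (pvIntegral n f g h ξ)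

/-- The trilinear operator `T_𝔫[f,g,h]` with Fourier transform `pvSymbol`. -/
def Tpv (n : ℝ × ℝ × ℝ × ℝ → ℂ) (f g h : ℝ → ℂ) (x : ℝ) : ℂ :=
  (Real.sqrt (2 * Real.pi) : ℂ)⁻¹ *
    ∫ ξ : ℝ, Complex.exp (Complex.I * (x : ℂ) * (ξ : ℂ)) * pvSymbol n f g h ξ

/-- The inverse Fourier transform on `ℝ⁴`. -/
def Finv4 (n : ℝ × ℝ × ℝ × ℝ → ℂ) (p : ℝ × ℝ × ℝ × ℝ) : ℂ :=
  ((Real.sqrt (2 * Real.pi) : ℂ) ^ 4)⁻¹ *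
    ∫ q : ℝ × ℝ × ℝ × ℝ,
      Complex.exp (Complex.I *
        ((p.1 * q.1 + p.2.1 * q.2.1 + p.2.2.1 * q.2.2.1 + p.2.2.2 * q.2.2.2 : ℝ) : ℂ)) * n q


/-! ### The kernel -/

lemma sinh_lower {s : ℝ} (hs : 0 ≤ s) : s * (1 + s ^ 2 / 6) ≤ Real.sinh s := by
  have h := sum_le_hasSum (Finset.range 2) (fun i _ => by positivity) (Real.hasSum_sinh s)
  simp [Finset.sum_range_succ, Nat.factorial] at h
  nlinarith

/-- The kernel `cosech (π t / 2)`. -/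
def hker (t : ℝ) : ℝ := csch (Real.pi * t / 2)

lemma ker_neg (t : ℝ) : hker (-t) = - hker t := by
  simp [hker, csch, neg_div, mul_neg, Real.sinh_neg]

lemma ker_pos {t : ℝ} (ht : 0 < t) : 0 < hker t := by
  have : 0 < Real.sinh (Real.pi * t / 2) := Real.sinh_pos_iff.2 (by positivity)
  unfold hker csch; positivity

lemma ker_measurable : Measurable hker := by
  unfold hker csch
  exact (measurable_const.div (Real.measurable_sinh.comp (by fun_prop)))

lemma mul_ker_le {t : ℝ} (ht : 0 < t) : t * hker t ≤ (1 + (t / 2) ^ 2)⁻¹ := by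
  have hpi := Real.pi_gt_three
  have h := sinh_lower (s := Real.pi * t / 2) (by positivity)
  have h0 : 0 < Real.sinh (Real.pi * t / 2) := Real.sinh_pos_iff.2 (by positivity)
  unfold hker csch
  rw [mul_one_div, div_le_iff₀ h0, ← div_eq_inv_mul, le_div_iff₀ (by positivity)]
  refine le_trans ?_ h
  have h1 : t ≤ Real.pi * t / 2 := by nlinarith
  have h2 : (t/2)^2 ≤ (Real.pi * t / 2)^2 / 6 := by nlinarith [mul_pos ht ht]
  gcongr

lemma ker_le {t : ℝ} (ht : 0 < t) : hker t ≤ 1 / t := by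
  rw [le_div_iff₀ ht, mul_comm]
  refine (mul_ker_le ht).trans ?_
  apply inv_le_one_of_one_le₀
  nlinarith [sq_nonneg (t/2)]

lemma integrable_bd : Integrable (fun t : ℝ => (1 + (t / 2) ^ 2)⁻¹) :=
  integrable_inv_one_add_sq.comp_div (by norm_num : (2 : ℝ) ≠ 0)

lemma ker_integrableOn {δ : ℝ} (hδ : 0 < δ) : IntegrableOn hker (Set.Ioi δ) := by
  refine Integrable.mono' (g := fun t => δ⁻¹ * (1 + (t / 2) ^ 2)⁻¹)
    ((integrable_bd.const_mul _).integrableOn) ker_measurable.aestronglyMeasurable ?_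
  filter_upwards [ae_restrict_mem measurableSet_Ioi] with t ht
  have ht' : δ < t := ht
  have h0 : 0 < t := hδ.trans ht'
  rw [Real.norm_of_nonneg (ker_pos h0).le, ← div_eq_inv_mul, le_div_iff₀ hδ]
  refine le_trans ?_ (mul_ker_le h0)
  rw [mul_comm]
  exact mul_le_mul_of_nonneg_right ht'.le (ker_pos h0).le

lemma absSet_eq {δ : ℝ} : {y : ℝ | δ ≤ |y|} = Set.Iic (-δ) ∪ Set.Ici δ := by
  ext y
  simp only [Set.mem_ofPred_eq, Set.mem_union, Set.mem_Iic, Set.mem_Ici, le_abs']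

lemma ker_integrableOn_Iic {δ : ℝ} (hδ : 0 < δ) : IntegrableOn hker (Set.Iic (-δ)) := by
  have h := (ker_integrableOn hδ)
  rw [← integrableOn_Ici_iff_integrableOn_Ioi] at h
  have h2 := h.comp_neg
  simp only [Set.neg_Ici] at h2
  have h3 := h2.neg
  refine h3.congr ?_
  filter_upwards with t
  simp [ker_neg]

lemma ker_integrableOn_abs {δ : ℝ} (hδ : 0 < δ) : IntegrableOn hker {y : ℝ | δ ≤ |y|} := by
  rw [absSet_eq]
  refine (ker_integrableOn_Iic hδ).union ?_
  rw [integrableOn_Ici_iff_integrableOn_Ioi]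
  exact ker_integrableOn hδ

/-- truncated kernel transform -/
def Kd (δ x : ℝ) : ℂ :=
  ∫ t in {y : ℝ | δ ≤ |y|}, (hker t : ℂ) * Complex.exp (Complex.I * ((x * t : ℝ) : ℂ))

/-- limit kernel -/
def Kl (x : ℝ) : ℂ :=
  2 * Complex.I * ((∫ t in Set.Ioi (0:ℝ), hker t * Real.sin (x * t) : ℝ) : ℂ)

lemma exp_norm (r : ℝ) : ‖Complex.exp (Complex.I * (r : ℂ))‖ = 1 := by
  rw [mul_comm]; exact Complex.norm_exp_ofReal_mul_I r

lemma Kd_eq {δ : ℝ} (hδ : 0 < δ) (x : ℝ) :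
    Kd δ x = 2 * Complex.I * ((∫ t in Set.Ioi δ, hker t * Real.sin (x * t) : ℝ) : ℂ) := by
  have hint : IntegrableOn (fun t => (hker t : ℂ) * Complex.exp (Complex.I * ((x * t : ℝ) : ℂ)))
      {y : ℝ | δ ≤ |y|} := by
    refine Integrable.mul_bdd (c := 1) (ker_integrableOn_abs hδ).ofReal ?_ ?_
    · exact Continuous.aestronglyMeasurable (by fun_prop)
    · filter_upwards with t
      rw [exp_norm]
  unfold Kd
  rw [absSet_eq] at hint ⊢
  have hdisj : Disjoint (Set.Iic (-δ)) (Set.Ici δ) := by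
    rw [Set.disjoint_left]
    intro y hy hy'
    simp only [Set.mem_Iic, Set.mem_Ici] at hy hy'
    linarith
  have hi1 := hint.mono_set Set.subset_union_left
  have hi2 := hint.mono_set Set.subset_union_right
  rw [setIntegral_union hdisj measurableSet_Ici hi1 hi2, ← integral_comp_neg_Ioi,
    integral_Ici_eq_integral_Ioi, ← integral_add]
  · rw [← integral_complex_ofReal, ← integral_const_mul]
    congr 1
    ext t
    rw [ker_neg]
    push_cast
    have h1 : Complex.I * ((x:ℂ) * -(t:ℂ)) = (-((x:ℂ) * t)) * Complex.I := by ring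
    have h2 : Complex.I * ((x:ℂ) * (t:ℂ)) = ((x:ℂ) * t) * Complex.I := by ring
    rw [h1, h2, Complex.exp_mul_I, Complex.exp_mul_I, Complex.cos_neg, Complex.sin_neg]
    ring
  · have := hi1.comp_neg
    rw [Set.neg_Iic, neg_neg, integrableOn_Ici_iff_integrableOn_Ioi] at this
    exact this
  · exact hi2.mono_set Set.Ioi_subset_Ici_self

lemma ker_sin_le {x t : ℝ} (ht : 0 < t) :
    ‖hker t * Real.sin (x * t)‖ ≤ |x| * (1 + (t / 2) ^ 2)⁻¹ := by
  rw [norm_mul, Real.norm_of_nonneg (ker_pos ht).le]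
  have h1 : ‖Real.sin (x * t)‖ ≤ |x| * t := by
    refine (Real.abs_sin_le_abs).trans ?_
    rw [abs_mul, abs_of_pos ht]
  calc hker t * ‖Real.sin (x*t)‖ ≤ hker t * (|x| * t) := by
        gcongr; exact (ker_pos ht).le
    _ = |x| * (t * hker t) := by ring
    _ ≤ _ := by gcongr; exact mul_ker_le ht

lemma ker_sin_meas (x : ℝ) : Measurable (fun t => hker t * Real.sin (x * t)) :=
  ker_measurable.mul (by fun_prop)

lemma Kd_tendsto (x : ℝ) : Tendsto (fun δ => Kd δ x) (𝓝[>] 0) (𝓝 (Kl x)) := by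
  have key : Tendsto (fun δ : ℝ => ∫ t in Set.Ioi (0:ℝ),
      (Set.Ioi δ).indicator (fun t => hker t * Real.sin (x * t)) t) (𝓝[>] 0)
      (𝓝 (∫ t in Set.Ioi (0:ℝ), hker t * Real.sin (x * t))) := by
    refine tendsto_integral_filter_of_dominated_convergence
      (fun t => |x| * (1 + (t / 2) ^ 2)⁻¹) ?_ ?_ ?_ ?_
    · filter_upwards with δ
      exact ((ker_sin_meas x).indicator measurableSet_Ioi).aestronglyMeasurable
    · filter_upwards with δ
      filter_upwards [ae_restrict_mem measurableSet_Ioi] with t ht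
      exact (norm_indicator_le_norm_self _ _).trans (ker_sin_le ht)
    · exact (integrable_bd.const_mul _).integrableOn
    · filter_upwards [ae_restrict_mem measurableSet_Ioi] with t ht
      refine tendsto_const_nhds.congr' ?_
      filter_upwards [nhdsWithin_le_nhds (Iio_mem_nhds (show (0:ℝ) < t from ht))] with δ hδ
      rw [Set.indicator_of_mem]
      exact hδ
  have h2 := ((Complex.continuous_ofReal.tendsto _).comp key).const_mul (2 * Complex.I)
  refine h2.congr' ?_
  filter_upwards [self_mem_nhdsWithin] with δ hδ
  have hδ' : 0 < δ := hδ
  rw [Kd_eq hδ', Function.comp, setIntegral_indicator measurableSet_Ioi]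
  congr 4
  ext t; simp; intro h; linarith

lemma Kl_continuous : Continuous Kl := by
  have : Continuous (fun x : ℝ => ∫ t in Set.Ioi (0:ℝ), hker t * Real.sin (x * t)) := by
    rw [continuous_iff_continuousAt]
    intro x₀
    refine continuousAt_of_dominated (bound := fun t => (|x₀| + 1) * (1 + (t / 2) ^ 2)⁻¹) ?_ ?_ ?_ ?_
    · filter_upwards with x using (ker_sin_meas x).aestronglyMeasurable
    · filter_upwards [Metric.ball_mem_nhds x₀ one_pos] with x hx
      filter_upwards [ae_restrict_mem measurableSet_Ioi] with t ht
      refine (ker_sin_le ht).trans ?_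
      gcongr
      rw [Metric.mem_ball, Real.dist_eq] at hx
      have := abs_sub_abs_le_abs_sub x x₀
      linarith
    · exact (integrable_bd.const_mul _).integrableOn
    · filter_upwards with t
      fun_prop
  unfold Kl
  fun_prop

lemma ker_hasDeriv {t : ℝ} (ht : 0 < t) :
    HasDerivAt hker (-(Real.cosh (Real.pi * t / 2) * (Real.pi / 2)) /
      (Real.sinh (Real.pi * t / 2)) ^ 2) t := by
  have h0 : 0 < Real.sinh (Real.pi * t / 2) := Real.sinh_pos_iff.2 (by positivity)
  have h1 : HasDerivAt (fun t : ℝ => Real.pi * t / 2) (Real.pi / 2) t := by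
    simpa using ((hasDerivAt_id t).const_mul Real.pi).div_const 2
  have h2 := (h1.sinh).inv h0.ne'
  refine h2.congr_of_eventuallyEq ?_
  filter_upwards with s
  simp [hker, csch]

lemma ker_tendsto : Tendsto hker atTop (𝓝 0) := by
  refine tendsto_of_tendsto_of_tendsto_of_le_of_le' tendsto_const_nhds
    (tendsto_const_nhds.div_atTop tendsto_id : Tendsto (fun t : ℝ => (1:ℝ) / id t) atTop (𝓝 0)) ?_ ?_
  · filter_upwards [eventually_gt_atTop 0] with t ht using (ker_pos ht).le
  · filter_upwards [eventually_gt_atTop 0] with t ht using ker_le ht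

lemma tail_bound {x a : ℝ} (hx : 0 < x) (ha : 0 < a) :
    |∫ t in Set.Ioi a, hker t * Real.sin (x * t)| ≤ 2 * hker a / x := by
  set u' : ℝ → ℝ := fun t => -(Real.cosh (Real.pi * t / 2) * (Real.pi / 2)) /
      (Real.sinh (Real.pi * t / 2)) ^ 2 with hu'
  set v : ℝ → ℝ := fun t => -Real.cos (x * t) / x with hv
  have hneg : ∀ t ∈ Set.Ioi a, u' t ≤ 0 := by
    intro t _
    simp only [hu', neg_div]
    have := Real.cosh_pos (Real.pi * t / 2)
    have := Real.pi_pos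
    rw [neg_nonpos]; positivity
  have hder : ∀ t ∈ Set.Ici a, HasDerivAt hker (u' t) t := fun t ht =>
    ker_hasDeriv (ha.trans_le ht)
  have hu'int : IntegrableOn u' (Set.Ioi a) :=
    integrableOn_Ioi_deriv_of_nonpos' hder hneg ker_tendsto
  have hu'val : ∫ t in Set.Ioi a, u' t = 0 - hker a :=
    integral_Ioi_of_hasDerivAt_of_nonpos' hder hneg ker_tendsto
  have hvd : ∀ t, HasDerivAt v (Real.sin (x * t)) t := by
    intro t
    have h1 : HasDerivAt (fun t : ℝ => x * t) x t := by
      simpa using (hasDerivAt_id t).const_mul x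
    have h2 := (h1.cos.neg).div_const x
    have h3 : -(-Real.sin (x * t) * x) / x = Real.sin (x * t) := by field_simp
    rw [h3] at h2
    exact h2
  have hvb : ∀ t, ‖v t‖ ≤ 1 / x := by
    intro t
    simp only [hv, norm_div, norm_neg, Real.norm_of_nonneg hx.le]
    gcongr
    exact Real.abs_cos_le_one _
  have hvc : Continuous v := by simp only [hv]; fun_prop
  have hu'v : IntegrableOn (u' * v) (Set.Ioi a) := by
    refine Integrable.mul_bdd (c := 1 / x) hu'int hvc.aestronglyMeasurable ?_
    filter_upwards with t using hvb t
  have hus : IntegrableOn (hker * fun t => Real.sin (x * t)) (Set.Ioi a) := by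
    refine Integrable.mul_bdd (c := 1) (ker_integrableOn ha)
      (Continuous.aestronglyMeasurable (by fun_prop)) ?_
    filter_upwards with t using Real.abs_sin_le_one _
  have hz : Tendsto (hker * v) (𝓝[>] a) (𝓝 (hker a * v a)) := by
    refine Tendsto.mono_left ?_ nhdsWithin_le_nhds
    exact ((hder a Set.self_mem_Ici).continuousAt.mul hvc.continuousAt)
  have hinf : Tendsto (hker * v) atTop (𝓝 0) := by
    refine Tendsto.zero_mul_isBoundedUnder_le ker_tendsto ?_
    exact ⟨1 / x, Filter.eventually_map.2 (Eventually.of_forall hvb)⟩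
  have := integral_Ioi_mul_deriv_eq_deriv_mul (u := hker) (v := v) (u' := u')
    (v' := fun t => Real.sin (x * t))
    (fun t ht => hder t (Set.Ioi_subset_Ici_self ht)) (fun t _ => hvd t) hus hu'v hz hinf
  rw [this]
  have hI : |∫ t in Set.Ioi a, u' t * v t| ≤ hker a / x := by
    calc |∫ t in Set.Ioi a, u' t * v t| ≤ ∫ t in Set.Ioi a, (- u' t) * (1 / x) := by
          rw [← Real.norm_eq_abs]
          refine norm_integral_le_of_norm_le (hu'int.neg.mul_const _) ?_
          filter_upwards [ae_restrict_mem measurableSet_Ioi] with t ht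
          rw [norm_mul, Real.norm_of_nonpos (hneg t ht)]
          have := hneg t ht
          exact mul_le_mul_of_nonneg_left (hvb t) (by linarith)
      _ = hker a / x := by
          rw [integral_mul_const, integral_neg, hu'val]; ring
  have hB : |hker a * v a| ≤ hker a / x := by
    rw [abs_mul, abs_of_pos (ker_pos ha), div_eq_mul_one_div]
    exact mul_le_mul_of_nonneg_left (hvb a) (ker_pos ha).le
  calc |0 - hker a * v a - ∫ t in Set.Ioi a, u' t * v t|
      ≤ |hker a * v a| + |∫ t in Set.Ioi a, u' t * v t| := by
        rw [zero_sub]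
        refine (abs_sub _ _).trans ?_
        rw [abs_neg]
    _ ≤ hker a / x + hker a / x := add_le_add hB hI
    _ = _ := by ring

lemma J_bound_pos {x δ : ℝ} (hx : 0 < x) (hδ : 0 < δ) :
    |∫ t in Set.Ioi δ, hker t * Real.sin (x * t)| ≤ 3 := by
  have tail : ∀ a, 1 / x ≤ a → |∫ t in Set.Ioi a, hker t * Real.sin (x * t)| ≤ 2 := by
    intro a ha
    have ha0 : 0 < a := lt_of_lt_of_le (by positivity) ha
    refine (tail_bound hx ha0).trans ?_
    rw [div_le_iff₀ hx]
    have h1 := ker_le ha0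
    have h2 : 1 / a ≤ x := by
      rw [div_le_iff₀ ha0]
      rw [div_le_iff₀ hx] at ha
      linarith
    linarith
  rcases le_total (1 / x) δ with h | h
  · linarith [tail δ h]
  have hint : IntegrableOn (fun t => hker t * Real.sin (x * t)) (Set.Ioi δ) := by
    refine Integrable.mul_bdd (c := 1) (ker_integrableOn hδ)
      (Continuous.aestronglyMeasurable (by fun_prop)) ?_
    filter_upwards with t using Real.abs_sin_le_one _
  rw [← Set.Ioc_union_Ioi_eq_Ioi h] at hint ⊢
  rw [setIntegral_union (Set.Ioc_disjoint_Ioi le_rfl) measurableSet_Ioi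
    (hint.mono_set Set.subset_union_left) (hint.mono_set Set.subset_union_right)]
  refine (abs_add_le _ _).trans ?_
  have hnear : |∫ t in Set.Ioc δ (1 / x), hker t * Real.sin (x * t)| ≤ 1 := by
    have := norm_setIntegral_le_of_norm_le_const (μ := volume) (s := Set.Ioc δ (1/x)) (C := x)
      (f := fun t => hker t * Real.sin (x * t)) (by simp) (fun t ht => by
        have h0 : 0 < t := hδ.trans ht.1
        refine (ker_sin_le h0).trans ?_
        rw [abs_of_pos hx]
        apply mul_le_of_le_one_right hx.le
        apply inv_le_one_of_one_le₀
        nlinarith [sq_nonneg (t/2)])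
    rw [Real.norm_eq_abs] at this
    refine this.trans ?_
    simp only [Measure.real, Real.volume_Ioc]
    rw [ENNReal.toReal_ofReal (by linarith)]
    rw [mul_sub, mul_one_div_cancel hx.ne']
    nlinarith
  linarith [tail (1/x) le_rfl]

lemma Kd_bound {δ : ℝ} (hδ : 0 < δ) (x : ℝ) : ‖Kd δ x‖ ≤ 6 := by
  rw [Kd_eq hδ]
  have : |∫ t in Set.Ioi δ, hker t * Real.sin (x * t)| ≤ 3 := by
    rcases lt_trichotomy x 0 with h | h | h
    · have := J_bound_pos (x := -x) (by linarith) hδ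
      simpa [integral_neg] using this
    · simp [h]
    · exact J_bound_pos h hδ
  rw [norm_mul, Complex.norm_real, Real.norm_eq_abs]
  simp
  linarith

lemma Kl_bound (x : ℝ) : ‖Kl x‖ ≤ 6 := by
  refine le_of_tendsto (Kd_tendsto x).norm ?_
  filter_upwards [self_mem_nhdsWithin] with δ hδ
  exact Kd_bound hδ x

/-! ### One-dimensional Fourier inversion -/

/-- the constant `√(2π)` -/
def s2 : ℂ := (Real.sqrt (2 * Real.pi) : ℂ)

lemma s2_sq : s2 ^ 2 = 2 * Real.pi := by
  unfold s2
  rw [← Complex.ofReal_pow, Real.sq_sqrt (by positivity)]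
  push_cast; rfl

lemma s2_ne : s2 ≠ 0 := by
  unfold s2
  exact_mod_cast (Real.sqrt_pos.2 (by positivity)).ne'

lemma FT_eq (f : ℝ → ℂ) (ξ : ℝ) :
    FT f ξ = s2⁻¹ * FourierTransform.fourier f (ξ / (2 * Real.pi)) := by
  rw [Real.fourier_real_eq_integral_exp_smul]
  unfold FT s2
  congr 1
  apply integral_congr_ae
  filter_upwards with x
  simp only [smul_eq_mul]
  congr 2
  have : (Real.pi : ℂ) ≠ 0 := by exact_mod_cast Real.pi_ne_zero
  push_cast
  field_simp

/-- Inversion: if `F` is continuous integrable and `FT F` is integrable. -/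
lemma FT_inversion {F : ℝ → ℂ} (hc : Continuous F) (hF : Integrable F)
    (hFT : Integrable (FT F)) (x : ℝ) :
    ∫ ξ : ℝ, FT F ξ * Complex.exp (Complex.I * ((x * ξ : ℝ) : ℂ)) = s2 * F x := by
  have hpi : (0:ℝ) < 2 * Real.pi := by positivity
  have h1 : Integrable (FourierTransform.fourier F) := by
    have h2 : Integrable (fun ξ => s2 * FT F ((2 * Real.pi) * ξ)) :=
      (hFT.comp_mul_left' hpi.ne').const_mul _
    refine h2.congr ?_
    filter_upwards with ξ
    rw [FT_eq, ← mul_assoc, mul_inv_cancel₀ s2_ne, one_mul, mul_div_cancel_left₀ _ hpi.ne']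
  have h3 := congrFun (hc.fourierInv_fourier_eq hF h1) x
  rw [Real.fourierInv_eq'] at h3
  rw [← h3]
  have h4 := Measure.integral_comp_div (fun v : ℝ =>
    Complex.exp ((2 * Real.pi * inner ℝ v x : ℝ) * Complex.I) • FourierTransform.fourier F v)
    (2 * Real.pi)
  rw [abs_of_pos hpi] at h4
  have h5 : (((2 * Real.pi : ℝ)) : ℂ) = s2 ^ 2 := by rw [s2_sq]; push_cast; rfl
  rw [Complex.real_smul, h5] at h4
  have h6 : s2 * ∫ v : ℝ, Complex.exp ((2 * Real.pi * inner ℝ v x : ℝ) * Complex.I) •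
      FourierTransform.fourier F v = s2⁻¹ * (s2 ^ 2 * ∫ v : ℝ,
      Complex.exp ((2 * Real.pi * inner ℝ v x : ℝ) * Complex.I) •
      FourierTransform.fourier F v) := by
    have h8 : ∀ J : ℂ, s2 * J = s2⁻¹ * (s2 ^ 2 * J) := by
      intro J
      have := s2_ne
      field_simp
    exact h8 _
  rw [h6, ← h4, ← integral_const_mul]
  apply integral_congr_ae
  filter_upwards with ξ
  rw [FT_eq]
  simp only [smul_eq_mul, RCLike.inner_apply, conj_trivial]
  have h7 : Complex.I * ((x * ξ : ℝ) : ℂ) =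
      ((2 * Real.pi * (x * (ξ / (2 * Real.pi))) : ℝ) : ℂ) * Complex.I := by
    have : 2 * Real.pi * (x * (ξ / (2 * Real.pi))) = x * ξ := by field_simp
    rw [this, mul_comm]
  rw [h7]
  ring

lemma FT_schwartz_integrable (f : SchwartzMap ℝ ℂ) : Integrable (FT f) := by
  have h : Integrable (fun ξ : ℝ => FourierTransform.fourier (f : ℝ → ℂ) ξ) := by
    rw [← SchwartzMap.fourier_coe]
    exact (FourierTransform.fourier f).integrable
  have := (h.comp_div (R := 2 * Real.pi) (by positivity)).const_mul s2⁻¹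
  refine this.congr ?_
  filter_upwards with ξ
  rw [FT_eq]

lemma FT_schwartz_inversion (f : SchwartzMap ℝ ℂ) (x : ℝ) :
    ∫ ξ : ℝ, FT f ξ * Complex.exp (Complex.I * ((x * ξ : ℝ) : ℂ)) = s2 * f x :=
  FT_inversion f.continuous f.integrable (FT_schwartz_integrable f) x

/-! ### Four-dimensional Fourier inversion -/

/-- ℝ⁴ with the Euclidean structure -/
abbrev V4 := WithLp 2 (ℝ × WithLp 2 (ℝ × WithLp 2 (ℝ × ℝ)))

/-- the identification -/
def L4 : V4 ≃L[ℝ] ℝ × ℝ × ℝ × ℝ :=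
  (WithLp.prodContinuousLinearEquiv 2 ℝ ℝ (WithLp 2 (ℝ × WithLp 2 (ℝ × ℝ)))).trans
    ((ContinuousLinearEquiv.refl ℝ ℝ).prodCongr
      ((WithLp.prodContinuousLinearEquiv 2 ℝ ℝ (WithLp 2 (ℝ × ℝ))).trans
        ((ContinuousLinearEquiv.refl ℝ ℝ).prodCongr
          (WithLp.prodContinuousLinearEquiv 2 ℝ ℝ ℝ))))

lemma L4_mp : MeasurePreserving (L4 : V4 → ℝ × ℝ × ℝ × ℝ) volume volume := by
  have h3 : MeasurePreserving (@WithLp.ofLp 2 (ℝ × ℝ)) := WithLp.volume_preserving_ofLp ℝ ℝ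
  have h2 := ((MeasurePreserving.id (volume : Measure ℝ)).prod h3).comp
    (WithLp.volume_preserving_ofLp ℝ (WithLp 2 (ℝ × ℝ)))
  exact ((MeasurePreserving.id (volume : Measure ℝ)).prod h2).comp
    (WithLp.volume_preserving_ofLp ℝ (WithLp 2 (ℝ × WithLp 2 (ℝ × ℝ))))

/-- dot product -/
def dot4 (p q : ℝ × ℝ × ℝ × ℝ) : ℝ :=
  p.1 * q.1 + p.2.1 * q.2.1 + p.2.2.1 * q.2.2.1 + p.2.2.2 * q.2.2.2

lemma inner_L4 (v w : V4) : inner ℝ v w = dot4 (L4 v) (L4 w) := by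
  simp [dot4, L4, WithLp.prod_inner_apply]
  ring

lemma finrank_V4 : Module.finrank ℝ V4 = 4 := by
  rw [L4.toLinearEquiv.finrank_eq]
  simp

lemma Finv4_eq (n : ℝ × ℝ × ℝ × ℝ → ℂ) (p : ℝ × ℝ × ℝ × ℝ) :
    Finv4 n p = (s2 ^ 4)⁻¹ * ∫ q, Complex.exp (Complex.I * (dot4 p q : ℂ)) * n q := rfl

/-- rescaled symbol on V4 -/
def nV (n : SchwartzMap (ℝ × ℝ × ℝ × ℝ) ℂ) : SchwartzMap V4 ℂ :=
  SchwartzMap.compCLMOfContinuousLinearEquiv ℂ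
    ((ContinuousLinearEquiv.smulLeft (Units.mk0 (2 * Real.pi) (by positivity : (2 * Real.pi) ≠ 0))).trans L4) n

lemma nV_apply (n : SchwartzMap (ℝ × ℝ × ℝ × ℝ) ℂ) (v : V4) :
    nV n v = n (L4 ((2 * Real.pi) • v)) := rfl

lemma integral_L4 (G : ℝ × ℝ × ℝ × ℝ → ℂ) : ∫ v, G (L4 v) = ∫ q, G q :=
  L4_mp.integral_comp L4.toHomeomorph.measurableEmbedding G

lemma fourierInv_nV (n : SchwartzMap (ℝ × ℝ × ℝ × ℝ) ℂ) (w : V4) :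
    FourierTransformInv.fourierInv (nV n) w = (s2 ^ 4)⁻¹ * Finv4 n (L4 w) := by
  have hpi : (0:ℝ) < 2 * Real.pi := by positivity
  rw [SchwartzMap.fourierInv_coe, Real.fourierInv_eq']
  have h := Measure.integral_comp_smul (volume : Measure V4) (fun v : V4 =>
    Complex.exp (Complex.I * (dot4 (L4 w) (L4 v) : ℂ)) * n (L4 v)) (2 * Real.pi)
  have h5 : (((2 * Real.pi : ℝ)) : ℂ) = s2 ^ 2 := by rw [s2_sq]; push_cast; rfl
  rw [finrank_V4, abs_of_pos (by positivity), Complex.real_smul, Complex.ofReal_inv,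
    Complex.ofReal_pow, h5,
    integral_L4 (fun q => Complex.exp (Complex.I * (dot4 (L4 w) q : ℂ)) * n q)] at h
  rw [Finv4_eq, ← mul_assoc, ← mul_inv, ← pow_add, show s2 ^ (4+4) = (s2^2)^4 by ring, ← h]
  apply integral_congr_ae
  filter_upwards with v
  rw [nV_apply, ← inner_L4, smul_eq_mul, inner_smul_right, real_inner_comm, mul_comm Complex.I]

lemma Finv4_integrable (n : SchwartzMap (ℝ × ℝ × ℝ × ℝ) ℂ) : Integrable (Finv4 n) := by
  rw [← L4_mp.integrable_comp_emb L4.toHomeomorph.measurableEmbedding]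
  have := (FourierTransformInv.fourierInv (nV n)).integrable (μ := volume) |>.const_mul (s2 ^ 4)
  refine this.congr ?_
  filter_upwards with w
  have := s2_ne
  rw [fourierInv_nV]
  simp only [Function.comp]
  field_simp

lemma Finv4_continuous (n : SchwartzMap (ℝ × ℝ × ℝ × ℝ) ℂ) : Continuous (Finv4 n) := by
  have : Finv4 n = fun q => s2 ^ 4 * FourierTransformInv.fourierInv (nV n) (L4.symm q) := by
    ext q
    have := s2_ne
    rw [fourierInv_nV]
    simp
    field_simp
  rw [this]
  have := (FourierTransformInv.fourierInv (nV n)).continuous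
  fun_prop

lemma n_eq (n : SchwartzMap (ℝ × ℝ × ℝ × ℝ) ℂ) (q : ℝ × ℝ × ℝ × ℝ) :
    n q = (s2 ^ 4)⁻¹ * ∫ y, Finv4 n y * Complex.exp (Complex.I * ((-dot4 y q : ℝ) : ℂ)) := by
  have hpi : (0:ℝ) < 2 * Real.pi := by positivity
  have h : FourierTransform.fourier (FourierTransformInv.fourierInv (nV n) : SchwartzMap V4 ℂ) =
    nV n := FourierTransform.fourier_fourierInv_eq _
  have h1 : FourierTransform.fourier (FourierTransformInv.fourierInv (nV n))
     ((2 * Real.pi)⁻¹ • L4.symm q) = n q := by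
    rw [h, nV_apply, smul_smul, mul_inv_cancel₀ hpi.ne']
    simp
  rw [← h1, SchwartzMap.fourier_coe, Real.fourier_eq', ← integral_L4, ← integral_const_mul]
  apply integral_congr_ae
  filter_upwards with v
  rw [fourierInv_nV, inner_smul_right, inner_L4, smul_eq_mul]
  have h2 : -2 * Real.pi * ((2 * Real.pi)⁻¹ * dot4 (L4 v) (L4 (L4.symm q))) = - dot4 (L4 v) q := by
    rw [L4.apply_symm_apply]; field_simp
  rw [h2, mul_comm Complex.I]
  ring

/-! ### Fubini, Minkowski, Hölder -/

lemma swap_lemma {W : Type*} [MeasurableSpace W] {μ : Measure W} [SFinite μ] {ν : Measure ℝ}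
    [SFinite ν] {A : W → ℂ} (hA : Integrable A μ) {φ : ℝ → ℂ} (hφ : Integrable φ ν)
    {a : W → ℝ} (ha : Measurable a) {Φ : ℝ → ℂ}
    (hΦ : ∀ t, ∫ ξ, φ ξ * Complex.exp (Complex.I * ((t * ξ : ℝ) : ℂ)) ∂ν = Φ t) :
    Integrable (fun w => A w * Φ (a w)) μ ∧
    ∫ ξ, φ ξ * (∫ w, A w * Complex.exp (Complex.I * ((a w * ξ : ℝ) : ℂ)) ∂μ) ∂ν =
      ∫ w, A w * Φ (a w) ∂μ := by
  have hG : Integrable (fun z : ℝ × W => φ z.1 * A z.2 *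
      Complex.exp (Complex.I * ((a z.2 * z.1 : ℝ) : ℂ))) (ν.prod μ) := by
    refine Integrable.mul_bdd (c := 1) (hφ.mul_prod hA) ?_ ?_
    · apply Measurable.aestronglyMeasurable
      fun_prop
    · filter_upwards with z
      rw [exp_norm]
  have hin : ∀ w, ∫ ξ, φ ξ * A w * Complex.exp (Complex.I * ((a w * ξ : ℝ) : ℂ)) ∂ν =
      A w * Φ (a w) := by
    intro w
    rw [← hΦ, ← integral_const_mul]
    congr 1; ext ξ; ring
  constructor
  · have := hG.integral_prod_right
    simpa only [hin] using this
  · have := integral_integral_swap (f := fun ξ w => φ ξ * A w *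
      Complex.exp (Complex.I * ((a w * ξ : ℝ) : ℂ))) hG
    simp only [hin] at this
    rw [← this]
    congr 1; ext ξ
    rw [← integral_const_mul]
    congr 1; ext w; ring

lemma minkowski_lemma {Y : Type*} [MeasurableSpace Y] {μ : Measure Y} [SFinite μ]
    {N : Y → ℂ} (hN : Measurable N) {H : Y → ℝ → ℂ} (hH : Measurable (fun z : Y × ℝ => H z.1 z.2))
    {p D : ℝ≥0∞} (hp : 1 ≤ p) (hD : ∀ y, eLpNorm (H y) p volume ≤ D) :
    eLpNorm (fun x => ∫ y, N y * H y x ∂μ) p volume ≤ (∫⁻ y, ‖N y‖ₑ ∂μ) * D := by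
  set ν : Measure Y := μ.withDensity (fun y => ‖N y‖ₑ) with hν
  set S := ∫⁻ y, ‖N y‖ₑ ∂μ with hS
  have hSν : ν Set.univ = S := by rw [hν, withDensity_apply _ MeasurableSet.univ]; simp [hS]
  have hHx : ∀ x, Measurable (fun y => H y x) := fun x => hH.comp measurable_prodMk_right
  have hbd : ∀ x, ‖∫ y, N y * H y x ∂μ‖ₑ ≤ ∫⁻ y, ‖H y x‖ₑ ∂ν := by
    intro x
    refine (enorm_integral_le_lintegral_enorm _).trans ?_
    rw [hν, lintegral_withDensity_eq_lintegral_mul _ hN.enorm (hHx x).enorm]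
    simp [enorm_mul]
  rcases eq_or_ne p ∞ with rfl | hpt
  · rw [eLpNorm_exponent_top]
    refine essSup_le_of_ae_le _ ?_
    have h1 : ∀ᵐ y ∂ν, ∀ᵐ x ∂(volume : Measure ℝ), ‖H y x‖ₑ ≤ D := by
      filter_upwards with y
      have := ae_le_eLpNormEssSup (f := H y) (μ := (volume : Measure ℝ))
      filter_upwards [this] with x hx
      refine hx.trans ?_
      have := hD y
      rwa [eLpNorm_exponent_top] at this
    rw [Measure.ae_ae_comm (p := fun y x => ‖H y x‖ₑ ≤ D)
      (measurableSet_le hH.enorm measurable_const)] at h1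
    filter_upwards [h1] with x hx
    refine (hbd x).trans ?_
    calc ∫⁻ y, ‖H y x‖ₑ ∂ν ≤ ∫⁻ y, D ∂ν := lintegral_mono_ae hx
      _ = S * D := by rw [lintegral_const, hSν, mul_comm]
  · have hp0 : p ≠ 0 := (zero_lt_one.trans_le hp).ne'
    set r := p.toReal with hr
    have hr1 : 1 ≤ r := by
      rw [hr, ← ENNReal.toReal_one]
      exact ENNReal.toReal_mono hpt hp
    have hr0 : 0 < r := by linarith
    have hDr : ∀ y, ∫⁻ x, ‖H y x‖ₑ ^ r ≤ D ^ r := by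
      intro y
      have := hD y
      rw [eLpNorm_eq_lintegral_rpow_enorm_toReal hp0 hpt, one_div, ENNReal.rpow_inv_le_iff hr0] at this
      exact this
    rw [eLpNorm_eq_lintegral_rpow_enorm_toReal hp0 hpt, one_div, ENNReal.rpow_inv_le_iff hr0]
    have hpt' : ∀ x, ‖∫ y, N y * H y x ∂μ‖ₑ ^ r ≤ (∫⁻ y, ‖H y x‖ₑ ^ r ∂ν) * S ^ (r - 1) := by
      intro x
      have h1 := eLpNorm_le_eLpNorm_mul_rpow_measure_univ (μ := ν) (f := fun y => H y x) hp
        (hHx x).aestronglyMeasurable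
      rw [eLpNorm_one_eq_lintegral_enorm, hSν] at h1
      calc ‖∫ y, N y * H y x ∂μ‖ₑ ^ r ≤ (∫⁻ y, ‖H y x‖ₑ ∂ν) ^ r := by
            gcongr; exact hbd x
        _ ≤ (eLpNorm (fun y => H y x) p ν * S ^ (1 / ENNReal.toReal 1 - 1 / r)) ^ r := by
            gcongr
        _ = _ := by
            rw [ENNReal.mul_rpow_of_nonneg _ _ hr0.le, ← ENNReal.rpow_mul,
              eLpNorm_eq_lintegral_rpow_enorm_toReal hp0 hpt, ← ENNReal.rpow_mul]
            congr 2
            · rw [← hr, one_div_mul_cancel hr0.ne', ENNReal.rpow_one]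
            · rw [ENNReal.toReal_one]; field_simp
    calc ∫⁻ x, ‖∫ y, N y * H y x ∂μ‖ₑ ^ r
        ≤ ∫⁻ x, (∫⁻ y, ‖H y x‖ₑ ^ r ∂ν) * S ^ (r - 1) := lintegral_mono hpt'
      _ = (∫⁻ x, ∫⁻ y, ‖H y x‖ₑ ^ r ∂ν) * S ^ (r - 1) := by
          rw [lintegral_mul_const]
          exact Measurable.lintegral_prod_left' (hH.enorm.pow_const r)
      _ = (∫⁻ y, (∫⁻ x, ‖H y x‖ₑ ^ r) ∂ν) * S ^ (r - 1) := by
          congr 1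
          rw [lintegral_lintegral_swap]
          exact ((hH.enorm.pow_const r).comp measurable_swap).aemeasurable
      _ ≤ (∫⁻ y, D ^ r ∂ν) * S ^ (r - 1) := by
          gcongr; exact hDr _
      _ = S ^ (1:ℝ) * S ^ (r - 1) * D ^ r := by
          rw [lintegral_const, hSν, ENNReal.rpow_one]; ring
      _ = (S * D) ^ r := by
          rw [← ENNReal.rpow_add_of_nonneg _ _ (by norm_num) (by linarith),
            ENNReal.mul_rpow_of_nonneg _ _ hr0.le]
          congr 2; ring

lemma eLpNorm_shift (f : SchwartzMap ℝ ℂ) (c : ℝ) (p : ℝ≥0∞) :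
    eLpNorm (fun x => f (x - c)) p volume = eLpNorm f p volume :=
  eLpNorm_comp_measurePreserving (p := p) (g := f) f.continuous.aestronglyMeasurable
    (measurePreserving_sub_right volume c)

lemma holder_lemma (f g h : SchwartzMap ℝ ℂ) {p p₁ p₂ p₃ : ℝ≥0∞}
    (hp : p⁻¹ = p₁⁻¹ + p₂⁻¹ + p₃⁻¹) (a b c d : ℝ) :
    eLpNorm (fun x => f (x - a) * g (x - b) * h (x - c) * Kl (x - d)) p volume ≤
      ENNReal.ofReal 6 * (eLpNorm f p₁ volume * eLpNorm g p₂ volume * eLpNorm h p₃ volume) := by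
  have hf : AEStronglyMeasurable (fun x => f (x - a)) volume :=
    (f.continuous.comp (by fun_prop)).aestronglyMeasurable
  have hg : AEStronglyMeasurable (fun x => g (x - b)) volume :=
    (g.continuous.comp (by fun_prop)).aestronglyMeasurable
  have hh : AEStronglyMeasurable (fun x => h (x - c)) volume :=
    (h.continuous.comp (by fun_prop)).aestronglyMeasurable
  have T1 : ENNReal.HolderTriple p₁ p₂ (p₁⁻¹ + p₂⁻¹)⁻¹ := ⟨by rw [inv_inv]⟩
  have T2 : ENNReal.HolderTriple (p₁⁻¹ + p₂⁻¹)⁻¹ p₃ p := ⟨by rw [inv_inv, hp]⟩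
  have h1 := eLpNorm_smul_le_mul_eLpNorm (p := p₁) (q := p₂) (r := (p₁⁻¹ + p₂⁻¹)⁻¹) hg hf
  have h2 := eLpNorm_smul_le_mul_eLpNorm (p := (p₁⁻¹ + p₂⁻¹)⁻¹) (q := p₃) (r := p) hh (hf.smul hg)
  have h3 : eLpNorm (fun x => f (x - a) * g (x - b) * h (x - c) * Kl (x - d)) p volume ≤
      ENNReal.ofReal 6 * eLpNorm (((fun x => f (x - a)) • (fun x => g (x - b))) •
        (fun x => h (x - c))) p volume := by
    apply eLpNorm_le_mul_eLpNorm_of_ae_le_mul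
    filter_upwards with x
    rw [norm_mul, mul_comm]
    exact mul_le_mul_of_nonneg_right (Kl_bound _) (norm_nonneg _)
  refine h3.trans ?_
  rw [eLpNorm_shift] at h1 h2
  rw [eLpNorm_shift] at h1
  gcongr
  refine h2.trans ?_
  gcongr

/-! ### Assembly -/

/-- `N(y) h(x - y₀)` -/
def Bw (n : SchwartzMap (ℝ × ℝ × ℝ × ℝ) ℂ) (h : SchwartzMap ℝ ℂ)
    (w : (ℝ × ℝ × ℝ × ℝ) × ℝ) : ℂ := Finv4 n w.1 * h (w.2 - w.1.1)

lemma Bw_integrable (n : SchwartzMap (ℝ × ℝ × ℝ × ℝ) ℂ) (h : SchwartzMap ℝ ℂ) :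
    Integrable (Bw n h) := by
  have hN := Finv4_continuous n
  have hh := h.continuous
  have hc : Continuous (Bw n h) := by unfold Bw; fun_prop
  rw [Measure.volume_eq_prod, integrable_prod_iff hc.aestronglyMeasurable]
  constructor
  · filter_upwards with y
    have h0 := ((h.integrable (μ := volume)).comp_sub_right y.1).const_mul (Finv4 n y)
    simpa only [Bw] using h0
  · have : (fun y => ∫ x, ‖Bw n h (y, x)‖) = fun y => ‖Finv4 n y‖ * ∫ x, ‖h x‖ := by
      ext y
      simp only [Bw, norm_mul]
      rw [integral_const_mul]
      congr 1
      exact integral_sub_right_eq_self (fun x => ‖h x‖) y.1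
    rw [this]
    exact (Finv4_integrable n).norm.mul_const _

lemma n_mul_FT (n : SchwartzMap (ℝ × ℝ × ℝ × ℝ) ℂ) (h : SchwartzMap ℝ ℂ)
    (q : ℝ × ℝ × ℝ × ℝ) (η : ℝ) :
    n q * FT h η = (s2 ^ 5)⁻¹ * ∫ w, Bw n h w *
      Complex.exp (Complex.I * ((-dot4 w.1 q - (w.2 - w.1.1) * η : ℝ) : ℂ)) := by
  have hint : Integrable (fun w => Bw n h w *
      Complex.exp (Complex.I * ((-dot4 w.1 q - (w.2 - w.1.1) * η : ℝ) : ℂ))) := by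
    refine Integrable.mul_bdd (c := 1) (Bw_integrable n h) ?_ ?_
    · apply Continuous.aestronglyMeasurable
      unfold dot4
      fun_prop
    · filter_upwards with w
      rw [exp_norm]
  rw [Measure.volume_eq_prod] at hint ⊢
  rw [integral_prod _ hint]
  have hin : ∀ y : ℝ × ℝ × ℝ × ℝ, ∫ x, Bw n h (y, x) *
      Complex.exp (Complex.I * ((-dot4 y q - (x - y.1) * η : ℝ) : ℂ)) =
      Finv4 n y * Complex.exp (Complex.I * ((-dot4 y q : ℝ) : ℂ)) * (s2 * FT h η) := by
    intro y
    have h1 : s2 * FT h η = ∫ x : ℝ, Complex.exp (-(Complex.I * (x : ℂ) * (η : ℂ))) * h x := by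
      unfold FT
      rw [← mul_assoc]
      change s2 * s2⁻¹ * _ = _
      rw [mul_inv_cancel₀ s2_ne, one_mul]
    rw [h1, ← integral_sub_right_eq_self
      (fun x : ℝ => Complex.exp (-(Complex.I * (x : ℂ) * (η : ℂ))) * h x) y.1, ← integral_const_mul]
    congr 1; ext x
    have h2 : Complex.I * ((-dot4 y q - (x - y.1) * η : ℝ) : ℂ) =
      Complex.I * ((-dot4 y q : ℝ) : ℂ) + (-(Complex.I * ((x - y.1 : ℝ) : ℂ) * (η : ℂ))) := by
      push_cast; ring
    rw [h2, Complex.exp_add, Bw]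
    ring
  simp only [hin]
  rw [integral_mul_const, n_eq n q]
  have := s2_ne
  field_simp

/-- base amplitude -/
def A0 (n : SchwartzMap (ℝ × ℝ × ℝ × ℝ) ℂ) (h : SchwartzMap ℝ ℂ) (ξ : ℝ)
    (w : (ℝ × ℝ × ℝ × ℝ) × ℝ) : ℂ :=
  Bw n h w * Complex.exp (Complex.I * ((-(w.2 * ξ) : ℝ) : ℂ))

lemma A0_integrable (n : SchwartzMap (ℝ × ℝ × ℝ × ℝ) ℂ) (h : SchwartzMap ℝ ℂ) (ξ : ℝ) :
    Integrable (A0 n h ξ) := by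
  refine Integrable.mul_bdd (c := 1) (Bw_integrable n h) ?_ ?_
  · exact Continuous.aestronglyMeasurable (by fun_prop)
  · filter_upwards with w
    rw [exp_norm]

/-- shift variables -/
def a1 (w : (ℝ × ℝ × ℝ × ℝ) × ℝ) : ℝ := w.2 - w.1.1 - w.1.2.1
/-- shift variables -/
def a2 (w : (ℝ × ℝ × ℝ × ℝ) × ℝ) : ℝ := w.2 - w.1.1 - w.1.2.2.1
/-- shift variables -/
def a3 (w : (ℝ × ℝ × ℝ × ℝ) × ℝ) : ℝ := w.2 - w.1.1 - w.1.2.2.2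

lemma a1_cont : Continuous a1 := by unfold a1; fun_prop
lemma a2_cont : Continuous a2 := by unfold a2; fun_prop
lemma a3_cont : Continuous a3 := by unfold a3; fun_prop

lemma integrable_mul_exp {A : (ℝ × ℝ × ℝ × ℝ) × ℝ → ℂ} (hA : Integrable A)
    {a : (ℝ × ℝ × ℝ × ℝ) × ℝ → ℝ} (ha : Continuous a) (t : ℝ) :
    Integrable (fun w => A w * Complex.exp (Complex.I * ((a w * t : ℝ) : ℂ))) := by
  refine Integrable.mul_bdd (c := 1) hA ?_ ?_
  · exact Continuous.aestronglyMeasurable (by fun_prop)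
  · filter_upwards with w
    rw [exp_norm]

lemma integrand_eq (n : SchwartzMap (ℝ × ℝ × ℝ × ℝ) ℂ) (f g h : SchwartzMap ℝ ℂ)
    (ξ ξ₁ ξ₂ ξ₃ : ℝ) :
    n (ξ, ξ₁, ξ₂, ξ₃) * FT f ξ₁ * FT g ξ₂ * FT h (ξ - ξ₁ - ξ₂ - ξ₃) *
      (csch (Real.pi * ξ₃ / 2) : ℂ) =
    ((s2 ^ 5)⁻¹ * hker ξ₃ * FT g ξ₂) * (FT f ξ₁ * ∫ w,
      (A0 n h ξ w * Complex.exp (Complex.I * ((a3 w * ξ₃ : ℝ) : ℂ)) *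
        Complex.exp (Complex.I * ((a2 w * ξ₂ : ℝ) : ℂ))) *
        Complex.exp (Complex.I * ((a1 w * ξ₁ : ℝ) : ℂ))) := by
  have h1 := n_mul_FT n h (ξ, ξ₁, ξ₂, ξ₃) (ξ - ξ₁ - ξ₂ - ξ₃)
  have h2 : ∀ w : (ℝ × ℝ × ℝ × ℝ) × ℝ, Bw n h w *
      Complex.exp (Complex.I * ((-dot4 w.1 (ξ, ξ₁, ξ₂, ξ₃) -
        (w.2 - w.1.1) * (ξ - ξ₁ - ξ₂ - ξ₃) : ℝ) : ℂ)) =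
      (A0 n h ξ w * Complex.exp (Complex.I * ((a3 w * ξ₃ : ℝ) : ℂ)) *
        Complex.exp (Complex.I * ((a2 w * ξ₂ : ℝ) : ℂ))) *
        Complex.exp (Complex.I * ((a1 w * ξ₁ : ℝ) : ℂ)) := by
    intro w
    unfold A0
    rw [mul_assoc, mul_assoc, mul_assoc, ← Complex.exp_add, ← Complex.exp_add, ← Complex.exp_add]
    congr 2
    simp only [dot4, a1, a2, a3]
    push_cast; ring
  simp only [h2] at h1
  change _ * (hker ξ₃ : ℂ) = _
  calc _ = (n (ξ, ξ₁, ξ₂, ξ₃) * FT h (ξ - ξ₁ - ξ₂ - ξ₃)) * (hker ξ₃ * FT g ξ₂ * FT f ξ₁) := by ring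
    _ = _ := by rw [h1]; ring

lemma amp_integrable (n : SchwartzMap (ℝ × ℝ × ℝ × ℝ) ℂ) (f g h : SchwartzMap ℝ ℂ) (ξ : ℝ) :
    Integrable (fun w => A0 n h ξ w * (s2 * f (a1 w)) * (s2 * g (a2 w))) :=
  (swap_lemma (swap_lemma (A0_integrable n h ξ) (FT_schwartz_integrable f) a1_cont.measurable
    (FT_schwartz_inversion f)).1 (FT_schwartz_integrable g) a2_cont.measurable
    (FT_schwartz_inversion g)).1

lemma pvIntegral_eq (n : SchwartzMap (ℝ × ℝ × ℝ × ℝ) ℂ) (f g h : SchwartzMap ℝ ℂ)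
    (ξ : ℝ) {δ : ℝ} (hδ : 0 < δ) :
    pvIntegral n f g h ξ δ = (s2 ^ 5)⁻¹ * ∫ w, A0 n h ξ w * (s2 * f (a1 w)) * (s2 * g (a2 w)) *
      Kd δ (a3 w) := by
  unfold pvIntegral
  simp only [integrand_eq]
  have step1 : ∀ ξ₃ ξ₂ : ℝ, ∫ ξ₁ : ℝ, ((s2 ^ 5)⁻¹ * hker ξ₃ * FT g ξ₂) * (FT f ξ₁ * ∫ w,
      (A0 n h ξ w * Complex.exp (Complex.I * ((a3 w * ξ₃ : ℝ) : ℂ)) *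
        Complex.exp (Complex.I * ((a2 w * ξ₂ : ℝ) : ℂ))) *
        Complex.exp (Complex.I * ((a1 w * ξ₁ : ℝ) : ℂ))) =
      ((s2 ^ 5)⁻¹ * hker ξ₃) * (FT g ξ₂ * ∫ w,
        (A0 n h ξ w * Complex.exp (Complex.I * ((a3 w * ξ₃ : ℝ) : ℂ)) * (s2 * f (a1 w))) *
        Complex.exp (Complex.I * ((a2 w * ξ₂ : ℝ) : ℂ))) := by
    intro ξ₃ ξ₂
    rw [integral_const_mul, (swap_lemma (integrable_mul_exp (integrable_mul_exp
      (A0_integrable n h ξ) a3_cont ξ₃) a2_cont ξ₂) (FT_schwartz_integrable f) a1_cont.measurable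
      (FT_schwartz_inversion f)).2, mul_assoc]
    congr 3; ext w; ring
  simp only [step1]
  have step2 : ∀ ξ₃ : ℝ, ∫ ξ₂ : ℝ, ((s2 ^ 5)⁻¹ * hker ξ₃) * (FT g ξ₂ * ∫ w,
        (A0 n h ξ w * Complex.exp (Complex.I * ((a3 w * ξ₃ : ℝ) : ℂ)) * (s2 * f (a1 w))) *
        Complex.exp (Complex.I * ((a2 w * ξ₂ : ℝ) : ℂ))) =
      (s2 ^ 5)⁻¹ * (hker ξ₃ * ∫ w, (A0 n h ξ w * (s2 * f (a1 w)) * (s2 * g (a2 w))) *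
        Complex.exp (Complex.I * ((a3 w * ξ₃ : ℝ) : ℂ))) := by
    intro ξ₃
    rw [integral_const_mul, (swap_lemma (swap_lemma (integrable_mul_exp
      (A0_integrable n h ξ) a3_cont ξ₃) (FT_schwartz_integrable f) a1_cont.measurable
      (FT_schwartz_inversion f)).1 (FT_schwartz_integrable g) a2_cont.measurable
      (FT_schwartz_inversion g)).2, mul_assoc]
    congr 3; ext w; ring
  simp only [step2]
  rw [integral_const_mul]
  congr 1
  exact (swap_lemma (ν := volume.restrict {y : ℝ | δ ≤ |y|}) (amp_integrable n f g h ξ)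
    (φ := fun t => (hker t : ℂ)) (ker_integrableOn_abs hδ).ofReal a3_cont.measurable
    (Φ := Kd δ) (fun t => rfl)).2

/-- the limit -/
def Mlim (n : SchwartzMap (ℝ × ℝ × ℝ × ℝ) ℂ) (f g h : SchwartzMap ℝ ℂ) (ξ : ℝ) : ℂ :=
  (s2 ^ 5)⁻¹ * ∫ w, A0 n h ξ w * (s2 * f (a1 w)) * (s2 * g (a2 w)) * Kl (a3 w)

lemma pvIntegral_tendsto (n : SchwartzMap (ℝ × ℝ × ℝ × ℝ) ℂ) (f g h : SchwartzMap ℝ ℂ) (ξ : ℝ) :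
    Tendsto (pvIntegral n f g h ξ) (𝓝[>] 0) (𝓝 (Mlim n f g h ξ)) := by
  have key : Tendsto (fun δ => ∫ w, A0 n h ξ w * (s2 * f (a1 w)) * (s2 * g (a2 w)) *
      Kd δ (a3 w)) (𝓝[>] 0)
      (𝓝 (∫ w, A0 n h ξ w * (s2 * f (a1 w)) * (s2 * g (a2 w)) * Kl (a3 w))) := by
    refine tendsto_integral_filter_of_dominated_convergence
      (fun w => ‖A0 n h ξ w * (s2 * f (a1 w)) * (s2 * g (a2 w))‖ * 6) ?_ ?_ ?_ ?_
    · filter_upwards [self_mem_nhdsWithin] with δ hδ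
      exact (swap_lemma (ν := volume.restrict {y : ℝ | δ ≤ |y|}) (amp_integrable n f g h ξ)
        (φ := fun t => (hker t : ℂ)) (ker_integrableOn_abs hδ).ofReal a3_cont.measurable
        (Φ := Kd δ) (fun t => rfl)).1.aestronglyMeasurable
    · filter_upwards [self_mem_nhdsWithin] with δ hδ
      filter_upwards with w
      rw [norm_mul]
      exact mul_le_mul_of_nonneg_left (Kd_bound hδ _) (norm_nonneg _)
    · exact (amp_integrable n f g h ξ).norm.mul_const _
    · filter_upwards with w
      exact (Kd_tendsto _).const_mul _
  refine (key.const_mul (s2 ^ 5)⁻¹).congr' ?_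
  filter_upwards [self_mem_nhdsWithin] with δ hδ
  rw [pvIntegral_eq n f g h ξ hδ]

lemma pvSymbol_eq (n : SchwartzMap (ℝ × ℝ × ℝ × ℝ) ℂ) (f g h : SchwartzMap ℝ ℂ) (ξ : ℝ) :
    pvSymbol n f g h ξ = Mlim n f g h ξ :=
  (pvIntegral_tendsto n f g h ξ).limUnder_eq

/-- the multilinear integrand for fixed `y` -/
def Hy (f g h : SchwartzMap ℝ ℂ) (y : ℝ × ℝ × ℝ × ℝ) (x : ℝ) : ℂ :=
  f (x - (y.1 + y.2.1)) * g (x - (y.1 + y.2.2.1)) * h (x - y.1) * Kl (x - (y.1 + y.2.2.2))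

/-- the physical-space operator (up to a constant) -/
def Fop (n : SchwartzMap (ℝ × ℝ × ℝ × ℝ) ℂ) (f g h : SchwartzMap ℝ ℂ) (x : ℝ) : ℂ :=
  ∫ y, Finv4 n y * Hy f g h y x

lemma Hy_cont (f g h : SchwartzMap ℝ ℂ) :
    Continuous (fun z : (ℝ × ℝ × ℝ × ℝ) × ℝ => Hy f g h z.1 z.2) := by
  have := f.continuous
  have := g.continuous
  have := h.continuous
  have := Kl_continuous
  unfold Hy
  fun_prop

lemma Hy_cont_left (f g h : SchwartzMap ℝ ℂ) (x : ℝ) :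
    Continuous (fun y : ℝ × ℝ × ℝ × ℝ => Hy f g h y x) := by
  have := f.continuous
  have := g.continuous
  have := h.continuous
  have := Kl_continuous
  unfold Hy
  fun_prop

lemma Hy_cont_right (f g h : SchwartzMap ℝ ℂ) (y : ℝ × ℝ × ℝ × ℝ) :
    Continuous (fun x : ℝ => Hy f g h y x) := by
  have := f.continuous
  have := g.continuous
  have := h.continuous
  have := Kl_continuous
  unfold Hy
  fun_prop

lemma schwartz_bdd (f : SchwartzMap ℝ ℂ) : ∃ C : ℝ, 0 ≤ C ∧ ∀ x, ‖f x‖ ≤ C :=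
  ⟨SchwartzMap.seminorm ℝ 0 0 f, by positivity, fun x => f.norm_le_seminorm ℝ x⟩

lemma Fop_cont (n : SchwartzMap (ℝ × ℝ × ℝ × ℝ) ℂ) (f g h : SchwartzMap ℝ ℂ) :
    Continuous (Fop n f g h) := by
  obtain ⟨Cf, hCf0, hCf⟩ := schwartz_bdd f
  obtain ⟨Cg, hCg0, hCg⟩ := schwartz_bdd g
  obtain ⟨Ch, hCh0, hCh⟩ := schwartz_bdd h
  have hN := Finv4_continuous n
  unfold Fop
  refine continuous_of_dominated (bound := fun y => ‖Finv4 n y‖ * (Cf * Cg * Ch * 6)) ?_ ?_ ?_ ?_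
  · intro x
    exact (hN.mul (Hy_cont_left f g h x)).aestronglyMeasurable
  · intro x
    filter_upwards with y
    rw [norm_mul]
    refine mul_le_mul_of_nonneg_left ?_ (norm_nonneg _)
    unfold Hy
    rw [norm_mul, norm_mul, norm_mul]
    gcongr
    · exact hCf _
    · exact hCg _
    · exact hCh _
    · exact Kl_bound _
  · exact (Finv4_integrable n).norm.mul_const _
  · filter_upwards with y
    exact continuous_const.mul (Hy_cont_right f g h y)

lemma H_eq (n : SchwartzMap (ℝ × ℝ × ℝ × ℝ) ℂ) (f g h : SchwartzMap ℝ ℂ) (ξ : ℝ)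
    (w : (ℝ × ℝ × ℝ × ℝ) × ℝ) :
    A0 n h ξ w * (s2 * f (a1 w)) * (s2 * g (a2 w)) * Kl (a3 w) =
     s2 ^ 2 * (Finv4 n w.1 * Hy f g h w.1 w.2 *
      Complex.exp (Complex.I * ((-(w.2 * ξ) : ℝ) : ℂ))) := by
  simp only [A0, Bw, Hy, a1, a2, a3, sub_sub]
  ring

lemma full_integrable (n : SchwartzMap (ℝ × ℝ × ℝ × ℝ) ℂ) (f g h : SchwartzMap ℝ ℂ) (ξ : ℝ) :
    Integrable (fun w : (ℝ × ℝ × ℝ × ℝ) × ℝ => Finv4 n w.1 * Hy f g h w.1 w.2 *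
      Complex.exp (Complex.I * ((-(w.2 * ξ) : ℝ) : ℂ))) := by
  have h1 : Integrable (fun w => A0 n h ξ w * (s2 * f (a1 w)) * (s2 * g (a2 w)) * Kl (a3 w)) := by
    refine Integrable.mul_bdd (c := 6) (amp_integrable n f g h ξ) ?_ ?_
    · exact (Kl_continuous.comp a3_cont).aestronglyMeasurable
    · filter_upwards with w using Kl_bound _
  simp only [H_eq] at h1
  have h2 := h1.const_mul (s2 ^ 2)⁻¹
  refine h2.congr ?_
  filter_upwards with w
  have := s2_ne
  field_simp

lemma Fop_integrable (n : SchwartzMap (ℝ × ℝ × ℝ × ℝ) ℂ) (f g h : SchwartzMap ℝ ℂ) :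
    Integrable (Fop n f g h) := by
  have := full_integrable n f g h 0
  simp only [mul_zero, neg_zero, Complex.ofReal_zero, Complex.exp_zero, mul_one] at this
  exact this.integral_prod_right

lemma Mlim_eq (n : SchwartzMap (ℝ × ℝ × ℝ × ℝ) ℂ) (f g h : SchwartzMap ℝ ℂ) (ξ : ℝ) :
    Mlim n f g h ξ = (s2 ^ 2)⁻¹ * FT (Fop n f g h) ξ := by
  unfold Mlim
  simp only [H_eq]
  have hint := full_integrable n f g h ξ
  rw [integral_const_mul]
  rw [Measure.volume_eq_prod] at hint ⊢
  rw [integral_prod_symm _ hint]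
  have : FT (Fop n f g h) ξ = s2⁻¹ * ∫ x, ∫ y, Finv4 n y * Hy f g h y x *
      Complex.exp (Complex.I * ((-(x * ξ) : ℝ) : ℂ)) := by
    unfold FT
    change s2⁻¹ * _ = _
    congr 2; ext x
    rw [integral_mul_const, mul_comm]
    congr 2
    push_cast; ring
  rw [this]
  have hs := s2_ne
  have hJ : ∀ J : ℂ, (s2 ^ 5)⁻¹ * (s2 ^ 2 * J) = (s2 ^ 2)⁻¹ * (s2⁻¹ * J) := by
    intro J
    field_simp
  exact hJ _

lemma Tpv_norm_le (n : SchwartzMap (ℝ × ℝ × ℝ × ℝ) ℂ) (f g h : SchwartzMap ℝ ℂ) (x : ℝ) :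
    ‖Tpv n f g h x‖ ≤ ‖Fop n f g h x‖ := by
  have hs2 := s2_ne
  have h1 : Tpv n f g h x = s2⁻¹ * ((s2 ^ 2)⁻¹ * ∫ ξ : ℝ, FT (Fop n f g h) ξ *
      Complex.exp (Complex.I * ((x * ξ : ℝ) : ℂ))) := by
    unfold Tpv
    change s2⁻¹ * _ = _
    congr 1
    rw [← integral_const_mul]
    congr 1; ext ξ
    rw [pvSymbol_eq, Mlim_eq]
    push_cast
    rw [← mul_assoc Complex.I]
    ring
  by_cases hI : Integrable (FT (Fop n f g h))
  · rw [h1, FT_inversion (Fop_cont n f g h) (Fop_integrable n f g h) hI x]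
    have h2 : s2⁻¹ * ((s2 ^ 2)⁻¹ * (s2 * Fop n f g h x)) = (s2 ^ 2)⁻¹ * Fop n f g h x := by
      field_simp
    rw [h2, norm_mul]
    apply mul_le_of_le_one_left (norm_nonneg _)
    rw [s2_sq, norm_inv]
    apply inv_le_one_of_one_le₀
    rw [norm_mul, Complex.norm_real, Real.norm_of_nonneg Real.pi_pos.le]
    have := Real.pi_gt_three
    norm_num
    linarith
  · have h2 : ∫ ξ : ℝ, FT (Fop n f g h) ξ *
      Complex.exp (Complex.I * ((x * ξ : ℝ) : ℂ)) = 0 := by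
      apply integral_undef
      intro hc
      apply hI
      have h3 : Integrable (fun ξ : ℝ => FT (Fop n f g h) ξ *
        Complex.exp (Complex.I * ((x * ξ : ℝ) : ℂ)) *
        Complex.exp (Complex.I * ((-(x * ξ) : ℝ) : ℂ))) := by
        refine Integrable.mul_bdd (c := 1) hc ?_ ?_
        · exact Continuous.aestronglyMeasurable (by fun_prop)
        · filter_upwards with w
          rw [exp_norm]
      refine h3.congr ?_
      filter_upwards with ξ
      rw [mul_assoc, ← Complex.exp_add, ← mul_add, ← Complex.ofReal_add]
      simp
    rw [h1, h2]
    simp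

/-- Existence of the principal-value limits and the Hölder-type bound for the trilinear
operator with a Hilbert-type kernel. -/
theorem pv_trilinear_operator_bound :
    ∃ C : ℝ, 0 < C ∧
      ∀ n : SchwartzMap (ℝ × ℝ × ℝ × ℝ) ℂ, ∀ f g h : SchwartzMap ℝ ℂ,
        (∀ ξ : ℝ,
          Tendsto (pvIntegral (⇑n) (⇑f) (⇑g) (⇑h) ξ) (𝓝[>] (0 : ℝ))
            (𝓝 (pvSymbol (⇑n) (⇑f) (⇑g) (⇑h) ξ))) ∧
        ∀ p p₁ p₂ p₃ : ℝ≥0∞, 1 ≤ p → 1 ≤ p₁ → 1 ≤ p₂ → 1 ≤ p₃ →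
          p⁻¹ = p₁⁻¹ + p₂⁻¹ + p₃⁻¹ →
          eLpNorm (Tpv (⇑n) (⇑f) (⇑g) (⇑h)) p volume ≤
            ENNReal.ofReal C * (∫⁻ q : ℝ × ℝ × ℝ × ℝ, ‖Finv4 (⇑n) q‖₊) *
              eLpNorm (⇑f) p₁ volume * eLpNorm (⇑g) p₂ volume * eLpNorm (⇑h) p₃ volume := by
  refine ⟨6, by norm_num, fun n f g h => ⟨fun ξ => ?_, fun p p₁ p₂ p₃ hp _ _ _ hpp => ?_⟩⟩
  · rw [pvSymbol_eq]
    exact pvIntegral_tendsto n f g h ξ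
  · refine (eLpNorm_mono (Tpv_norm_le n f g h)).trans ?_
    have h1 := minkowski_lemma (μ := (volume : Measure (ℝ × ℝ × ℝ × ℝ)))
      (Finv4_continuous n).measurable (Hy_cont f g h).measurable hp
      (fun y => holder_lemma f g h hpp (y.1 + y.2.1) (y.1 + y.2.2.1) y.1 (y.1 + y.2.2.2))
    refine h1.trans (le_of_eq ?_)
    simp only [enorm_eq_nnnorm]
    ring
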